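/- arXiv:1502.01563 — 3 statements merged into one kernel-verified Lean document; each statement's English description precedes it below -/
import Mathlib

section
/- For every k ≥ 1, the iterates of the Frank–Wolfe algorithm with the predefined stepsize rule λ^(k) = 2/(k+2) satisfy f(α^(k)) − f(α*) ≤ 4·C_f/(k+2), where α* is any minimizer of f over Σ. -/
open scoped RealInnerProductSpace

/-- The first-order characterization of convexity: a convex function lies above its tangent
plane. -/
theorem ConvexOn.inner_gradient_le_sub {E : Type*} [NormedAddCommGroup E] [InnerProductSpace ℝ E]
    [CompleteSpace E] {f : E → ℝ} (hf : ConvexOn ℝ Set.univ f) {x y g : E}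
    (hg : HasGradientAt f g x) : ⟪y - x, g⟫ ≤ f y - f x := by
  have hline : ConvexOn ℝ Set.univ (f ∘ AffineMap.lineMap (k := ℝ) x y) := by
    simpa using hf.comp_affineMap (AffineMap.lineMap (k := ℝ) x y)
  have hderiv : HasDerivAt (f ∘ AffineMap.lineMap (k := ℝ) x y) ⟪y - x, g⟫ 0 := by
    have hg' : HasFDerivAt f (InnerProductSpace.toDual ℝ E g)
        (AffineMap.lineMap (k := ℝ) x y 0) := by
      simpa using hg.hasFDerivAt
    have := hg'.comp_hasDerivAt (0 : ℝ) AffineMap.hasDerivAt_lineMap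
    rwa [InnerProductSpace.toDual_apply_apply, real_inner_comm] at this
  simpa [slope_def_field] using
    hline.le_slope_of_hasDerivAt (Set.mem_univ 0) (Set.mem_univ 1) zero_lt_one hderiv

/-- Sublinear convergence of the Frank–Wolfe algorithm with the predefined
stepsize rule `λ^(k) = 2/(k+2)`: for every `k ≥ 1`,
`f(α^(k)) − f(α*) ≤ 4 C_f / (k+2)`. -/
theorem fw_sublinear_convergence_predefined_stepsize
    {m : ℕ} (S : Set (EuclideanSpace ℝ (Fin m)))
    (hSne : S.Nonempty) (hScomp : IsCompact S) (hSconv : Convex ℝ S)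
    (f : EuclideanSpace ℝ (Fin m) → ℝ)
    (g : EuclideanSpace ℝ (Fin m) → EuclideanSpace ℝ (Fin m))
    (hfconv : ConvexOn ℝ Set.univ f)
    (hgrad : ∀ x, HasGradientAt f (g x) x)
    (Cf : ℝ)
    (hCf : ∀ x ∈ S, ∀ s ∈ S, ∀ γ ∈ Set.Ioc (0:ℝ) 1,
      f (x + γ • (s - x)) - f x - ⟪γ • (s - x), g x⟫ ≤ γ ^ 2 / 2 * Cf)
    (α u : ℕ → EuclideanSpace ℝ (Fin m))
    (hα0 : α 0 ∈ S)
    (huS : ∀ k, u k ∈ S)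
    (humin : ∀ k, ∀ v ∈ S, ⟪u k - α k, g (α k)⟫ ≤ ⟪v - α k, g (α k)⟫)
    (hstep : ∀ k : ℕ, α (k + 1) = α k + (2 / ((k : ℝ) + 2)) • (u k - α k))
    (αstar : EuclideanSpace ℝ (Fin m))
    (hαstar : αstar ∈ S) (hmin : ∀ v ∈ S, f αstar ≤ f v) :
    ∀ k : ℕ, 1 ≤ k → f (α k) - f αstar ≤ 4 * Cf / ((k : ℝ) + 2) := by
  have hC : 0 ≤ Cf := by
    have := hCf _ hα0 _ hα0 1 ⟨one_pos, le_rfl⟩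
    simp at this
    linarith
  have hstep_mem (k : ℕ) : 2 / ((k : ℝ) + 2) ∈ Set.Ioc (0 : ℝ) 1 :=
    ⟨by positivity, div_le_one_of_le₀ (by linarith [k.cast_nonneg (α := ℝ)]) (by positivity)⟩
  have hαS (k : ℕ) : α k ∈ S := by
    induction k with
    | zero => exact hα0
    | succ k ih =>
      rw [hstep]
      exact hSconv.add_smul_sub_mem ih (huS k) ⟨(hstep_mem k).1.le, (hstep_mem k).2⟩
  have hdescent (k : ℕ) : f (α (k + 1)) - f αstar ≤
      (1 - 2 / ((k : ℝ) + 2)) * (f (α k) - f αstar) + (2 / ((k : ℝ) + 2)) ^ 2 / 2 * Cf := by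
    have hcurv := hCf _ (hαS k) _ (huS k) _ (hstep_mem k)
    rw [← hstep, real_inner_smul_left] at hcurv
    have hgap := (humin k αstar hαstar).trans (hfconv.inner_gradient_le_sub (hgrad (α k)))
    have := mul_le_mul_of_nonneg_left hgap (hstep_mem k).1.le
    linarith
  intro k hk
  induction k, hk using Nat.le_induction with
  | base =>
    have := hdescent 0
    norm_num at this ⊢
    linarith
  | succ k _ ih =>
    have hk0 : (0 : ℝ) ≤ k := k.cast_nonneg
    calc f (α (k + 1)) - f αstar
        ≤ (1 - 2 / ((k : ℝ) + 2)) * (4 * Cf / (k + 2)) + (2 / ((k : ℝ) + 2)) ^ 2 / 2 * Cf :=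
          (hdescent k).trans <| by
            gcongr
            exact sub_nonneg.2 (hstep_mem k).2
      _ = (4 * k + 2) * Cf / ((k : ℝ) + 2) ^ 2 := by field_simp; ring
      _ ≤ 4 * Cf / (((k + 1 : ℕ) : ℝ) + 2) := by
        rw [div_le_div_iff₀ (by positivity) (by positivity)]
        push_cast
        nlinarith [mul_nonneg hC hk0]
end

section
/- For every k ≥ 1, the iterates of the Frank–Wolfe algorithm with exact line-search satisfy f(α^(k)) − f(α*) ≤ 4·C_f/(k+2), where α* is any minimizer of f over Σ. -/
open scoped RealInnerProductSpace

/-- First-order characterization of convexity: a convex function lies above its tangent planes. -/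
theorem ConvexOn.add_inner_gradient_le {E : Type*} [NormedAddCommGroup E] [InnerProductSpace ℝ E]
    [CompleteSpace E] {f : E → ℝ} (hf : ConvexOn ℝ Set.univ f) {x f' : E}
    (hx : HasGradientAt f f' x) (y : E) : f x + ⟪y - x, f'⟫ ≤ f y := by
  have hline : ConvexOn ℝ Set.univ (fun t : ℝ => f (AffineMap.lineMap x y t)) :=
    hf.comp_affineMap (AffineMap.lineMap x y : ℝ →ᵃ[ℝ] E)
  have hderiv : HasDerivAt (fun t : ℝ => f (AffineMap.lineMap x y t)) ⟪y - x, f'⟫ 0 := by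
    have hl : HasDerivAt (fun t : ℝ => (AffineMap.lineMap x y t : E)) (y - x) 0 :=
      AffineMap.hasDerivAt_lineMap
    have hx' : HasFDerivAt f (InnerProductSpace.toDual ℝ E f')
        (AffineMap.lineMap x y (0 : ℝ)) := by
      simpa using hx.hasFDerivAt
    have h := hx'.comp_hasDerivAt (0 : ℝ) hl
    rwa [InnerProductSpace.toDual_apply_apply, real_inner_comm] at h
  have h := hline.le_slope_of_hasDerivAt (Set.mem_univ 0) (Set.mem_univ 1) one_pos hderiv
  simp only [slope_def_field, AffineMap.lineMap_apply_zero, AffineMap.lineMap_apply_one,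
    sub_zero, div_one] at h
  linarith

/-- A sequence contracting by `1 - γ` up to an error `γ ^ 2 / 2 * C`, for every `γ ∈ (0, 1]`,
decays at rate `O(1 / k)`. -/
theorem le_four_mul_div_of_forall_contraction {h : ℕ → ℝ} {C : ℝ} (hC : 0 ≤ C)
    (hh : ∀ k, ∀ γ ∈ Set.Ioc (0 : ℝ) 1, h (k + 1) ≤ (1 - γ) * h k + γ ^ 2 / 2 * C) (k : ℕ) :
    h (k + 1) ≤ 4 * C / ((k : ℝ) + 3) := by
  induction k with
  | zero =>
    have h1 := hh 0 1 (by simp)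
    norm_num at h1 ⊢
    linarith
  | succ k ih =>
    have hk : (0 : ℝ) ≤ k := k.cast_nonneg
    have hγ : 2 / ((k : ℝ) + 3) ≤ 1 := by rw [div_le_one (by positivity)]; linarith
    calc h (k + 1 + 1)
        ≤ (1 - 2 / ((k : ℝ) + 3)) * h (k + 1) + (2 / ((k : ℝ) + 3)) ^ 2 / 2 * C :=
          hh (k + 1) _ ⟨by positivity, hγ⟩
      _ ≤ (1 - 2 / ((k : ℝ) + 3)) * (4 * C / ((k : ℝ) + 3))
            + (2 / ((k : ℝ) + 3)) ^ 2 / 2 * C := by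
          gcongr
      _ = (4 * k + 6) * C / ((k : ℝ) + 3) ^ 2 := by field_simp; ring
      _ ≤ 4 * C / (((k + 1 : ℕ) : ℝ) + 3) := by
          push_cast
          rw [div_le_div_iff₀ (by positivity) (by positivity)]
          nlinarith [mul_nonneg hC hk]

/-- Sublinear convergence of the Frank–Wolfe algorithm with exact line-search:
for every `k ≥ 1`, `f(α^(k)) − f(α*) ≤ 4 C_f / (k+2)`. -/
theorem fw_sublinear_convergence_line_search
    {m : ℕ} (S : Set (EuclideanSpace ℝ (Fin m)))
    (hSne : S.Nonempty) (hScomp : IsCompact S) (hSconv : Convex ℝ S)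
    (f : EuclideanSpace ℝ (Fin m) → ℝ)
    (g : EuclideanSpace ℝ (Fin m) → EuclideanSpace ℝ (Fin m))
    (hfconv : ConvexOn ℝ Set.univ f)
    (hgrad : ∀ x, HasGradientAt f (g x) x)
    (Cf : ℝ)
    (hCf : ∀ x ∈ S, ∀ s ∈ S, ∀ γ ∈ Set.Ioc (0:ℝ) 1,
      f (x + γ • (s - x)) - f x - ⟪γ • (s - x), g x⟫ ≤ γ ^ 2 / 2 * Cf)
    (α u : ℕ → EuclideanSpace ℝ (Fin m)) (lam : ℕ → ℝ)
    (hα0 : α 0 ∈ S)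
    (huS : ∀ k, u k ∈ S)
    (humin : ∀ k, ∀ v ∈ S, ⟪u k - α k, g (α k)⟫ ≤ ⟪v - α k, g (α k)⟫)
    (hlam : ∀ k, lam k ∈ Set.Icc (0:ℝ) 1)
    (hlinesearch : ∀ k, ∀ t ∈ Set.Icc (0:ℝ) 1,
      f (α k + lam k • (u k - α k)) ≤ f (α k + t • (u k - α k)))
    (hstep : ∀ k : ℕ, α (k + 1) = α k + lam k • (u k - α k))
    (αstar : EuclideanSpace ℝ (Fin m))
    (hαstar : αstar ∈ S) (hmin : ∀ v ∈ S, f αstar ≤ f v) :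
    ∀ k : ℕ, 1 ≤ k → f (α k) - f αstar ≤ 4 * Cf / ((k : ℝ) + 2) := by
  have hC : 0 ≤ Cf := by
    have h := hCf (α 0) hα0 (α 0) hα0 1 (by simp)
    norm_num at h
    linarith
  have hα : ∀ k, α k ∈ S := by
    intro k
    induction k with
    | zero => exact hα0
    | succ k ih => exact hstep k ▸ hSconv.add_smul_sub_mem ih (huS k) (hlam k)
  have hcontr : ∀ k, ∀ γ ∈ Set.Ioc (0 : ℝ) 1,
      f (α (k + 1)) - f αstar ≤ (1 - γ) * (f (α k) - f αstar) + γ ^ 2 / 2 * Cf := by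
    intro k γ hγ
    have hls := hlinesearch k γ ⟨hγ.1.le, hγ.2⟩
    rw [← hstep] at hls
    have hcurv := hCf (α k) (hα k) (u k) (huS k) γ hγ
    rw [real_inner_smul_left] at hcurv
    have hgap : ⟪u k - α k, g (α k)⟫ ≤ f αstar - f (α k) := by
      linarith [humin k αstar hαstar, hfconv.add_inner_gradient_le (hgrad (α k)) αstar]
    linarith [mul_le_mul_of_nonneg_left hgap hγ.1.le]
  intro k hk
  obtain ⟨n, rfl⟩ := Nat.exists_eq_add_of_le' hk
  convert le_four_mul_div_of_forall_contraction
    (h := fun k => f (α k) - f αstar) hC hcontr n using 2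
  push_cast
  ring
end

section
/- For every K ≥ 2, among the first K iterates of the Frank–Wolfe algorithm with the predefined stepsize rule there exists an index k̄ with 1 ≤ k̄ ≤ K such that Δ_d(α^(k̄)) ≤ 27·C_f/(2(K+2)). -/
open scoped RealInnerProductSpace

/-- A function with a gradient lies above its tangent plane, if it is convex. -/
theorem ConvexOn.inner_gradient_le {E : Type*} [NormedAddCommGroup E] [InnerProductSpace ℝ E]
    [CompleteSpace E] {f : E → ℝ} (hf : ConvexOn ℝ Set.univ f) {x v : E}
    (hv : HasGradientAt f v x) (y : E) : ⟪y - x, v⟫ ≤ f y - f x := by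
  have hline : ConvexOn ℝ Set.univ (fun t : ℝ => f (AffineMap.lineMap x y t)) :=
    hf.comp_affineMap (AffineMap.lineMap x y)
  have hderiv : HasDerivAt (fun t : ℝ => f (AffineMap.lineMap x y t)) ⟪v, y - x⟫ 0 := by
    have h0 : HasFDerivAt f (InnerProductSpace.toDual ℝ E v)
        (AffineMap.lineMap x y (0 : ℝ)) := by
      simpa using hv.hasFDerivAt
    have h1 := h0.comp_hasDerivAt (0 : ℝ) AffineMap.hasDerivAt_lineMap
    rwa [InnerProductSpace.toDual_apply_apply] at h1
  have h := hline.le_slope_of_hasDerivAt (Set.mem_univ 0) (Set.mem_univ 1) one_pos hderiv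
  simpa [slope_def_field, real_inner_comm] using h

/-- Sublinear decay of the primal error under the step sizes `2 / (k + 2)`. -/
theorem primal_error_le {h Δ : ℕ → ℝ} {C : ℝ} (hC : 0 ≤ C) (hle : ∀ k, h k ≤ Δ k)
    (hrec : ∀ k : ℕ, h (k + 1) ≤
      h k - 2 / ((k : ℝ) + 2) * Δ k + (2 / ((k : ℝ) + 2)) ^ 2 / 2 * C) (k : ℕ) :
    h (k + 1) ≤ 2 * C / ((k : ℝ) + 3) := by
  induction k with
  | zero =>
    have h0 := hrec 0
    have h1 := hle 0
    norm_num at h0 ⊢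
    linarith
  | succ k ih =>
    have h0 := hrec (k + 1)
    have h1 := mul_le_mul_of_nonneg_left (hle (k + 1))
      (by positivity : 0 ≤ 2 / (((k + 1 : ℕ) : ℝ) + 2))
    push_cast at h0 h1 ⊢
    have hk : (0 : ℝ) ≤ k := k.cast_nonneg
    have h2 : (1 - 2 / ((k : ℝ) + 1 + 2)) * h (k + 1) ≤
        (1 - 2 / ((k : ℝ) + 1 + 2)) * (2 * C / (k + 3)) := by
      refine mul_le_mul_of_nonneg_left ih ?_
      rw [sub_nonneg, div_le_one (by positivity)]
      linarith
    have h3 : (1 - 2 / ((k : ℝ) + 1 + 2)) * (2 * C / (k + 3)) +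
        (2 / ((k : ℝ) + 1 + 2)) ^ 2 / 2 * C ≤ 2 * C / (k + 1 + 3) := by
      have h4 : 2 * C / ((k : ℝ) + 1 + 3) - ((1 - 2 / ((k : ℝ) + 1 + 2)) * (2 * C / (k + 3)) +
          (2 / ((k : ℝ) + 1 + 2)) ^ 2 / 2 * C) = 2 * C / ((k + 4) * (k + 3) ^ 2) := by
        rw [show (k : ℝ) + 1 + 2 = k + 3 by ring, show (k : ℝ) + 1 + 3 = k + 4 by ring]
        field_simp
        ring
      have h5 : 0 ≤ 2 * C / (((k : ℝ) + 4) * (k + 3) ^ 2) := by positivity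
      linarith
    linarith

/-- Primal progress along a window of steps on which the duality gap is at least `M`. -/
theorem primal_error_window_le {h Δ : ℕ → ℝ} {C M : ℝ} {K p : ℕ} (hC : 0 ≤ C) (hM : 0 ≤ M)
    (hrec : ∀ k : ℕ, h (k + 1) ≤
      h k - 2 / ((k : ℝ) + 2) * Δ k + (2 / ((k : ℝ) + 2)) ^ 2 / 2 * C)
    (hMΔ : ∀ k, p ≤ k → k ≤ K → M ≤ Δ k) (j : ℕ) (hj : p + j ≤ K + 1) :
    h (p + j) ≤ h p + 2 * C * (1 / ((p : ℝ) + 1) - 1 / ((p : ℝ) + 1 + j)) -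
      2 * M * j / ((K : ℝ) + 2) := by
  induction j with
  | zero => simp
  | succ j ih =>
    have ih := ih (by omega)
    have h0 := hrec (p + j)
    have hle : (p : ℝ) + j ≤ K := by exact_mod_cast (by omega : p + j ≤ K)
    push_cast at h0 ⊢
    have h1 : 2 / ((K : ℝ) + 2) * M ≤ 2 / ((p : ℝ) + j + 2) * Δ (p + j) := by
      have := hMΔ (p + j) (by omega) (by omega)
      gcongr
    have h2 : (2 / ((p : ℝ) + j + 2)) ^ 2 / 2 * C ≤
        2 * C * (1 / ((p : ℝ) + 1 + j) - 1 / ((p : ℝ) + 1 + (j + 1))) := by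
      have h3 : 2 * C * (1 / ((p : ℝ) + 1 + j) - 1 / ((p : ℝ) + 1 + (j + 1))) -
          (2 / ((p : ℝ) + j + 2)) ^ 2 / 2 * C =
          2 * C / ((p + 1 + j) * (p + j + 2) ^ 2) := by
        rw [show (p : ℝ) + 1 + (j + 1) = p + j + 2 by ring]
        field_simp
        ring
      have h4 : 0 ≤ 2 * C / (((p : ℝ) + 1 + j) * (p + j + 2) ^ 2) := by positivity
      linarith
    have h5 : 2 * M * ((j : ℝ) + 1) / (K + 2) = 2 * M * j / (K + 2) + 2 / (K + 2) * M := by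
      ring
    rw [← add_assoc]
    linarith

/-- Among the first `K` terms some duality gap is `O(C / K)`. -/
theorem exists_gap_le {h Δ : ℕ → ℝ} {C : ℝ} {K : ℕ} (hC : 0 ≤ C) (hle : ∀ k, h k ≤ Δ k)
    (hΔ : ∀ k, 0 ≤ Δ k)
    (hrec : ∀ k : ℕ, h (k + 1) ≤
      h k - 2 / ((k : ℝ) + 2) * Δ k + (2 / ((k : ℝ) + 2)) ^ 2 / 2 * C)
    (hK : 2 ≤ K) (hlast : 0 ≤ h (K + 1)) :
    ∃ k, 1 ≤ k ∧ k ≤ K ∧ Δ k ≤ 27 * C / (2 * ((K : ℝ) + 2)) := by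
  obtain ⟨k, hk, hmin⟩ := (Finset.Icc 1 K).exists_min_image Δ ⟨1, by simp; omega⟩
  rw [Finset.mem_Icc] at hk
  refine ⟨k, hk.1, hk.2, ?_⟩
  obtain ⟨q, n, hq1, hqn, hnq, hqnK⟩ : ∃ q n : ℕ, 1 ≤ q ∧ n ≤ q + 1 ∧ q ≤ n ∧ q + 1 + n = K + 1 :=
    ⟨K / 2, K - K / 2, by omega, by omega, by omega, by omega⟩
  have hp := primal_error_le hC hle hrec (q - 1)
  have hw := primal_error_window_le (K := K) (p := q) hC (hΔ k) hrec
    (fun i hi hi' => hmin i (Finset.mem_Icc.2 ⟨by omega, hi'⟩)) (n + 1) (by omega)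
  rw [show q + (n + 1) = K + 1 by omega] at hw
  rw [Nat.sub_add_cancel hq1, Nat.cast_sub hq1] at hp
  have hKq : (K : ℝ) = q + n := by exact_mod_cast (by omega : K = q + n)
  have hnq' : (q : ℝ) ≤ n := by exact_mod_cast hnq
  have hqn' : (n : ℝ) ≤ q + 1 := by exact_mod_cast hqn
  have hq0 : (1 : ℝ) ≤ q := by exact_mod_cast hq1
  have hpq : 2 * C / ((q : ℝ) - (1 : ℕ) + 3) ≤ 2 * C / (q + 1) := by
    refine div_le_div_of_nonneg_left (by positivity) (by positivity) ?_
    push_cast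
    linarith
  push_cast at hw
  have hD' : (q : ℝ) + 1 + (n + 1) = K + 2 := by rw [hKq]; ring
  rw [hD'] at hw
  set D : ℝ := K + 2
  have hDpos : 0 < D := by positivity
  have hsum : 2 * Δ k * (n + 1) / D ≤ 2 * C * (2 / (q + 1) - 1 / D) := by
    have : 2 * C * (2 / ((q : ℝ) + 1) - 1 / D) =
      2 * C / (q + 1) + 2 * C * (1 / (q + 1) - 1 / D) := by ring
    linarith
  have hDn : D ≤ 2 * (n + 1) := by linarith
  have hDq : D ≤ 2 * (q + 1) + 1 := by linarith
  have hD4 : 4 ≤ D := by linarith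
  have hgap : Δ k ≤ 2 * Δ k * (n + 1) / D := by
    rw [le_div_iff₀ hDpos]
    nlinarith [hΔ k]
  have hinv : 2 / ((q : ℝ) + 1) - 1 / D ≤ 27 / (4 * D) := by
    have : 2 / ((q : ℝ) + 1) ≤ 31 / (4 * D) := by
      rw [div_le_div_iff₀ (by positivity) (by positivity)]
      linarith
    have h2 : 31 / (4 * D) = 27 / (4 * D) + 1 / D := by field_simp; norm_num
    linarith
  calc Δ k ≤ 2 * C * (2 / (q + 1) - 1 / D) := hgap.trans hsum
    _ ≤ 2 * C * (27 / (4 * D)) := by gcongr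
    _ = 27 * C / (2 * D) := by field_simp; ring

/-- Primal-dual convergence of the Frank–Wolfe algorithm with the predefined
stepsize rule: for every `K ≥ 2` there is an iterate `α^(k̄)` with `1 ≤ k̄ ≤ K`
whose duality gap satisfies `Δ_d(α^(k̄)) ≤ 27 C_f / (2 (K+2))`. -/
theorem fw_primal_dual_convergence
    {m : ℕ} (S : Set (EuclideanSpace ℝ (Fin m)))
    (hSne : S.Nonempty) (hScomp : IsCompact S) (hSconv : Convex ℝ S)
    (f : EuclideanSpace ℝ (Fin m) → ℝ)
    (g : EuclideanSpace ℝ (Fin m) → EuclideanSpace ℝ (Fin m))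
    (hfconv : ConvexOn ℝ Set.univ f)
    (hgrad : ∀ x, HasGradientAt f (g x) x)
    (Cf : ℝ)
    (hCf : ∀ x ∈ S, ∀ s ∈ S, ∀ γ ∈ Set.Ioc (0:ℝ) 1,
      f (x + γ • (s - x)) - f x - ⟪γ • (s - x), g x⟫ ≤ γ ^ 2 / 2 * Cf)
    (α u : ℕ → EuclideanSpace ℝ (Fin m))
    (hα0 : α 0 ∈ S)
    (huS : ∀ k, u k ∈ S)
    (humin : ∀ k, ∀ v ∈ S, ⟪u k - α k, g (α k)⟫ ≤ ⟪v - α k, g (α k)⟫)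
    (hstep : ∀ k : ℕ, α (k + 1) = α k + (2 / ((k : ℝ) + 2)) • (u k - α k))
    (Δd : ℕ → ℝ)
    (hΔd : ∀ k, IsGreatest ((fun v => ⟪α k - v, g (α k)⟫) '' S) (Δd k)) :
    ∀ K : ℕ, 2 ≤ K → ∃ kbar : ℕ, 1 ≤ kbar ∧ kbar ≤ K ∧
      Δd kbar ≤ 27 * Cf / (2 * ((K : ℝ) + 2)) := by
  have hα : ∀ k, α k ∈ S := by
    intro k
    induction k with
    | zero => exact hα0
    | succ k ih =>
      rw [hstep]
      exact hSconv.add_smul_sub_mem ih (huS k)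
        ⟨by positivity, by rw [div_le_one (by positivity)]; linarith [k.cast_nonneg (α := ℝ)]⟩
  have hC : 0 ≤ Cf := by
    obtain ⟨x, hx⟩ := hSne
    have := hCf x hx x hx 1 (by norm_num)
    simp at this
    linarith
  have hgap_ge : ∀ k, ∀ v ∈ S, ⟪α k - v, g (α k)⟫ ≤ Δd k :=
    fun k v hv => (hΔd k).2 ⟨v, hv, rfl⟩
  have hgap_le : ∀ k, Δd k ≤ -⟪u k - α k, g (α k)⟫ := by
    intro k
    obtain ⟨v, hv, hveq⟩ := (hΔd k).1
    have := humin k v hv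
    simp only at hveq
    rw [← hveq, ← neg_sub v, inner_neg_left]
    linarith
  intro K hK
  refine exists_gap_le (h := fun k => f (α k) - f (α (K + 1))) hC ?_ ?_ ?_ hK (by simp)
  · intro k
    have h1 := hfconv.inner_gradient_le (hgrad (α k)) (α (K + 1))
    have h2 := hgap_ge k _ (hα (K + 1))
    rw [← neg_sub, inner_neg_left] at h2
    linarith
  · intro k
    simpa using hgap_ge k _ (hα k)
  · intro k
    have hpos : (0 : ℝ) < 2 / ((k : ℝ) + 2) := by positivity
    have h1 := hCf (α k) (hα k) (u k) (huS k) (2 / ((k : ℝ) + 2))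
      ⟨hpos, by rw [div_le_one (by positivity)]; linarith [k.cast_nonneg (α := ℝ)]⟩
    rw [← hstep, real_inner_smul_left] at h1
    have h2 := mul_le_mul_of_nonneg_left (hgap_le k) hpos.le
    linarith
end
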